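/- Assume ν satisfies (N1) and (N2) with 0 < β < 1. Then there exists a constant c > 0 such that for every r ∈ (0,1]: f̃(r) ≤ c r^{−d} Ψ(1/r) and f(r) ≤ c r^{−d−1} Ψ(1/r); moreover, for every x ∈ ℝ^d with |x| ≥ 2 and every r ∈ (0,1], ∫_{{y ∈ ℝ^d : |x−y| ≥ 1, |y| > r}} f̃(|x−y|) ν(|y|) dy ≤ c Ψ(1/r) f̃(|x|), and for every x ∈ ℝ^{d+2} with |x| ≥ 2 and every r ∈ (0,1], ∫_{{y ∈ ℝ^{d+2} : |x−y| ≥ 1, |y| > r}} f(|x−y|) ν₁(|y|) dy ≤ c Ψ(1/r) f(|x|). -/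

import Mathlib

open MeasureTheory Filter Set

attribute [local instance] Classical.propDecidable

/-- `φ̂(r) = r² / ∫₀^r s^{d+1} ν(s) ds` for `0 < r ≤ 1`, and `φ̂(r) = φ̂(1) r²` for `r > 1`. -/
noncomputable def phiHat (d : ℕ) (ν : ℝ → ℝ) (r : ℝ) : ℝ :=
  if r ≤ 1 then r ^ 2 / ∫ s in Set.Ioo (0:ℝ) r, s ^ (d + 1) * ν s
  else (1 / ∫ s in Set.Ioo (0:ℝ) 1, s ^ (d + 1) * ν s) * r ^ 2

/-- `ν₁(r) = -ν′(r) / (2π r)`. -/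
noncomputable def nu1 (ν : ℝ → ℝ) (r : ℝ) : ℝ := -(deriv ν r) / (2 * Real.pi * r)

/-- The radial characteristic exponent of the symmetric Lévy measure `ν(|z|)dz`:
`ψ(ρ) = ∫_{ℝ^d} (1 - cos(ρ z₁)) ν(|z|) dz`. -/
noncomputable def psi (d : ℕ) (hd : 0 < d) (ν : ℝ → ℝ) (ρ : ℝ) : ℝ :=
  ∫ z : EuclideanSpace ℝ (Fin d), (1 - Real.cos (ρ * z ⟨0, hd⟩)) * ν ‖z‖

/-- `Ψ(r) = sup_{0 < s ≤ r} ψ(s)`. -/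
noncomputable def Psi (d : ℕ) (hd : 0 < d) (ν : ℝ → ℝ) (r : ℝ) : ℝ :=
  sSup (psi d hd ν '' Set.Ioc 0 r)

/-- Generalized inverse `Ψ⁻¹(u) = inf{s > 0 : Ψ(s) ≥ u}`. -/
noncomputable def PsiInv (d : ℕ) (hd : 0 < d) (ν : ℝ → ℝ) (u : ℝ) : ℝ :=
  sInf {s : ℝ | 0 < s ∧ u ≤ Psi d hd ν s}

/-- `f(r) = φ̂(1)/(r^{d+1} φ̂(r))` for `0 < r ≤ 1`, `f(r) = r^{-ℓ-1} e^{-b r^β}` for `r > 1`. -/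
noncomputable def ffun (d : ℕ) (ν : ℝ → ℝ) (b β ℓ : ℝ) (r : ℝ) : ℝ :=
  if r ≤ 1 then phiHat d ν 1 / (r ^ (d + 1) * phiHat d ν r)
  else r ^ (-ℓ - 1) * Real.exp (-b * r ^ β)

/-- `f̃(r) = φ̂(1)/(r^d φ̂(r))` for `0 < r ≤ 1`, `f̃(r) = r^{-ℓ} e^{-b r^β}` for `r > 1`. -/
noncomputable def ftil (d : ℕ) (ν : ℝ → ℝ) (b β ℓ : ℝ) (r : ℝ) : ℝ :=
  if r ≤ 1 then phiHat d ν 1 / (r ^ d * phiHat d ν r)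
  else r ^ (-ℓ) * Real.exp (-b * r ^ β)

structure NuAssumptions (d : ℕ) (ν : ℝ → ℝ) (a b β ℓ a₃ α₃ : ℝ) : Prop where
  ν_pos : ∀ r : ℝ, 0 < r → 0 < ν r
  ν_anti : AntitoneOn ν (Set.Ioi 0)
  ν_diff : ∀ r : ℝ, 0 < r → DifferentiableAt ℝ ν r
  ν_int : MeasureTheory.Integrable
      (fun y : EuclideanSpace ℝ (Fin d) => min 1 (‖y‖ ^ 2) * ν ‖y‖)
  ha : 0 < a
  hb : 0 < b
  β_pos : 0 < β
  β_le : β ≤ 1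
  ℓ_nonneg : 0 ≤ ℓ
  hN1 : ∀ r : ℝ, 1 < r → ν r ≤ a * r ^ (-ℓ) * Real.exp (-b * r ^ β)
  a₃_pos : 0 < a₃
  α₃_pos : 0 < α₃
  α₃_le : α₃ ≤ 2
  hN2 : ∀ r R : ℝ, 0 < r → r ≤ R → a₃ * (R / r) ^ α₃ ≤ phiHat d ν R / phiHat d ν r

/-- The tail profile `s ↦ s^{-p} e^{-b s^β}` on `[1, ∞)`, extended by its value at `1`. -/
noncomputable def tailProfile (b β p s : ℝ) : ℝ :=
  (max 1 s) ^ (-p) * Real.exp (-b * (max 1 s) ^ β)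

lemma tailProfile_pos (b β p s : ℝ) : 0 < tailProfile b β p s := by
  have : (0:ℝ) < max 1 s := by positivity
  unfold tailProfile
  positivity

lemma continuous_tailProfile (b β p : ℝ) : Continuous (tailProfile b β p) := by
  have h : ∀ s : ℝ, max 1 s ≠ 0 := fun s => (by positivity : (0:ℝ) < max 1 s).ne'
  unfold tailProfile
  refine Continuous.mul ?_ (Real.continuous_exp.comp (continuous_const.mul ?_))
  · exact (continuous_const.max continuous_id).rpow_const fun s => Or.inl (h s)
  · exact (continuous_const.max continuous_id).rpow_const fun s => Or.inl (h s)

lemma tailProfile_of_one_le {b β p s : ℝ} (hs : 1 ≤ s) :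
    tailProfile b β p s = s ^ (-p) * Real.exp (-b * s ^ β) := by
  rw [tailProfile, max_eq_right hs]

lemma tailProfile_add_one {b β p s : ℝ} (hs : 1 ≤ s) :
    s * tailProfile b β (p + 1) s = tailProfile b β p s := by
  rw [tailProfile_of_one_le hs, tailProfile_of_one_le hs, ← mul_assoc]
  congr 1
  have h0 : 0 < s := by linarith
  rw [show -p = 1 + -(p + 1) by ring, Real.rpow_add h0, Real.rpow_one]

lemma tailProfile_le_of_abs_sub_le {b β p s t : ℝ} (hb : 0 ≤ b) (hβ : 0 ≤ β) (hβ1 : β ≤ 1)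
    (hp : 0 ≤ p) (hst : |s - t| ≤ 1) :
    tailProfile b β p s ≤ 2 ^ p * Real.exp b * tailProfile b β p t := by
  have hle : max 1 t ≤ max 1 s + 1 := by
    have := (abs_le.1 hst).1
    rcases le_total 1 t with h | h <;> rcases le_total 1 s with h' | h' <;>
      simp only [max_eq_left, max_eq_right, *] <;> linarith
  have hM : 1 ≤ max 1 s := le_max_left _ _
  have hN : 1 ≤ max 1 t := le_max_left _ _
  unfold tailProfile
  generalize max 1 s = M at *
  generalize max 1 t = N at *
  have h1 : M ^ (-p) ≤ 2 ^ p * N ^ (-p) := by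
    have hN2 : N ^ p ≤ 2 ^ p * M ^ p := by
      rw [← Real.mul_rpow (by norm_num) (by linarith)]
      exact Real.rpow_le_rpow (by linarith) (by linarith) hp
    have hMp : 0 < M ^ p := Real.rpow_pos_of_pos (by linarith) _
    have hNp : 0 < N ^ p := Real.rpow_pos_of_pos (by linarith) _
    rw [Real.rpow_neg (by linarith), Real.rpow_neg (by linarith), ← div_eq_mul_inv,
      le_div_iff₀ hNp, inv_mul_le_iff₀ hMp]
    linarith
  have h2 : Real.exp (-b * M ^ β) ≤ Real.exp b * Real.exp (-b * N ^ β) := by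
    rw [← Real.exp_add]
    apply Real.exp_le_exp.2
    have h3 : N ^ β ≤ M ^ β + 1 := by
      have := Real.rpow_add_le_add_rpow (a := M) (b := 1) (by linarith) zero_le_one hβ hβ1
      rw [Real.one_rpow] at this
      exact (Real.rpow_le_rpow (by linarith) hle hβ).trans this
    nlinarith
  calc M ^ (-p) * Real.exp (-b * M ^ β)
      ≤ (2 ^ p * N ^ (-p)) * (Real.exp b * Real.exp (-b * N ^ β)) := by gcongr
    _ = _ := by ring

/-- Concavity gain: the sum of `β`-th powers exceeds the `β`-th power of the sum by a multiple
of the `β`-th power of the smaller term. -/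
lemma rpow_add_le_sub_mul_rpow {β m M : ℝ} (hβ : 0 ≤ β) (hβ1 : β ≤ 1) (hm : 0 < m) (hmM : m ≤ M) :
    (M + m) ^ β + (1 - β) * m ^ β ≤ M ^ β + m ^ β := by
  have hM : 0 < M := hm.trans_le hmM
  have h1 : (M + m) ^ β ≤ M ^ β * (1 + β * (m / M)) := by
    have h := _root_.rpow_one_add_le_one_add_mul_self (s := m / M)
      (by have := div_pos hm hM; linarith) hβ hβ1
    calc (M + m) ^ β = (M * (1 + m / M)) ^ β := by congr 1; field_simp
      _ = M ^ β * (1 + m / M) ^ β := Real.mul_rpow hM.le (by positivity)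
      _ ≤ _ := by gcongr
  have h2 : M ^ β * (m / M) ≤ m ^ β := by
    have h3 : m / M ≤ (m / M) ^ β := by
      have := Real.rpow_le_rpow_of_exponent_ge (div_pos hm hM) ((div_le_one hM).2 hmM) hβ1
      rwa [Real.rpow_one] at this
    calc M ^ β * (m / M) ≤ M ^ β * (m / M) ^ β := by gcongr
      _ = m ^ β := by
        rw [← Real.mul_rpow hM.le (by positivity)]; congr 1; field_simp
  nlinarith

lemma tailProfile_mul_le {b β p s t X : ℝ} (hb : 0 ≤ b) (hβ : 0 ≤ β) (hβ1 : β ≤ 1)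
    (hp : 0 ≤ p) (hs : 0 ≤ s) (ht : 0 ≤ t) (hX : X ≤ s + t) :
    tailProfile b β p s * tailProfile b β p t ≤
      2 ^ p * tailProfile b β p X *
        (Real.exp (-(b * (1 - β)) * s ^ β) + Real.exp (-(b * (1 - β)) * t ^ β)) := by
  have key : ∀ m M Y u : ℝ, 1 ≤ m → m ≤ M → 1 ≤ Y → Y ≤ M + m → 0 ≤ u → u ≤ m →
      (m ^ (-p) * Real.exp (-b * m ^ β)) * (M ^ (-p) * Real.exp (-b * M ^ β)) ≤
      2 ^ p * (Y ^ (-p) * Real.exp (-b * Y ^ β)) * Real.exp (-(b * (1 - β)) * u ^ β) := by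
    intro m M Y u hm hmM hY hYM hu hum
    have h1 : m ^ (-p) ≤ 1 := Real.rpow_le_one_of_one_le_of_nonpos hm (by linarith)
    have h2 : M ^ (-p) ≤ 2 ^ p * Y ^ (-p) := by
      have hY2 : Y ^ p ≤ 2 ^ p * M ^ p := by
        rw [← Real.mul_rpow (by norm_num) (by linarith)]
        exact Real.rpow_le_rpow (by linarith) (by linarith) hp
      have hMp : 0 < M ^ p := Real.rpow_pos_of_pos (by linarith) _
      have hNp : 0 < Y ^ p := Real.rpow_pos_of_pos (by linarith) _
      rw [Real.rpow_neg (by linarith), Real.rpow_neg (by linarith), ← div_eq_mul_inv,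
        le_div_iff₀ hNp, inv_mul_le_iff₀ hMp]
      linarith
    have h3 : Real.exp (-b * m ^ β) * Real.exp (-b * M ^ β) ≤
        Real.exp (-b * Y ^ β) * Real.exp (-(b * (1 - β)) * u ^ β) := by
      rw [← Real.exp_add, ← Real.exp_add]
      apply Real.exp_le_exp.2
      have h4 := rpow_add_le_sub_mul_rpow hβ hβ1 (by linarith) hmM
      have h5 : Y ^ β ≤ (M + m) ^ β := Real.rpow_le_rpow (by linarith) hYM hβ
      have h6 : (1 - β) * u ^ β ≤ (1 - β) * m ^ β :=
        mul_le_mul_of_nonneg_left (Real.rpow_le_rpow hu hum hβ) (by linarith)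
      nlinarith
    have hM0 : 0 ≤ M ^ (-p) := Real.rpow_nonneg (by linarith) _
    calc (m ^ (-p) * Real.exp (-b * m ^ β)) * (M ^ (-p) * Real.exp (-b * M ^ β))
        = m ^ (-p) * M ^ (-p) * (Real.exp (-b * m ^ β) * Real.exp (-b * M ^ β)) := by ring
      _ ≤ 1 * (2 ^ p * Y ^ (-p)) *
          (Real.exp (-b * Y ^ β) * Real.exp (-(b * (1 - β)) * u ^ β)) := by gcongr
      _ = _ := by ring
  have hXp := tailProfile_pos b β p X
  unfold tailProfile at *
  have hXle : max 1 X ≤ max 1 s + max 1 t := by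
    have h1 := le_max_left 1 s
    have h2 := le_max_left 1 t
    have h3 := le_max_right 1 s
    have h4 := le_max_right 1 t
    exact max_le (by linarith) (by linarith)
  have hE : ∀ u : ℝ, 0 ≤ 2 ^ p * (max 1 X ^ (-p) * Real.exp (-b * max 1 X ^ β)) *
      Real.exp (-(b * (1 - β)) * u ^ β) := fun u => by positivity
  rw [mul_add]
  rcases le_total (max 1 s) (max 1 t) with h | h
  · have := key (max 1 s) (max 1 t) (max 1 X) s (le_max_left _ _) h (le_max_left _ _)
      (by linarith) hs (le_max_right _ _)
    linarith [hE t]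
  · have := key (max 1 t) (max 1 s) (max 1 X) t (le_max_left _ _) h (le_max_left _ _)
      (by linarith) ht (le_max_right _ _)
    linarith [hE s]

lemma integrable_exp_neg_mul_norm_rpow {E : Type*} [NormedAddCommGroup E] [NormedSpace ℝ E]
    [FiniteDimensional ℝ E] [Nontrivial E] [MeasurableSpace E] [BorelSpace E] (μ : Measure E)
    [μ.IsAddHaarMeasure] {c β : ℝ} (hc : 0 < c) (hβ : 0 < β) :
    Integrable (fun y : E => Real.exp (-c * ‖y‖ ^ β)) μ := by
  rw [integrable_fun_norm_addHaar μ (f := fun s : ℝ => Real.exp (-c * s ^ β))]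
  have h := integrableOn_rpow_mul_exp_neg_mul_rpow (p := β)
    (s := ((Module.finrank ℝ E - 1 : ℕ) : ℝ)) (b := c)
    (lt_of_lt_of_le (by norm_num) (Nat.cast_nonneg _)) hβ hc
  simpa only [Real.rpow_natCast, smul_eq_mul] using h

/-- Integration in polar coordinates, for nonnegative functions. -/
lemma lintegral_eq_lintegral_toSphere {E : Type*} [NormedAddCommGroup E] [NormedSpace ℝ E]
    [FiniteDimensional ℝ E] [Nontrivial E] [MeasurableSpace E] [BorelSpace E] (μ : Measure E)
    [μ.IsAddHaarMeasure] {F : E → ENNReal} (hF : Measurable F) :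
    ∫⁻ y, F y ∂μ = ∫⁻ ω, (∫⁻ s in Ioi (0:ℝ),
      ENNReal.ofReal (s ^ (Module.finrank ℝ E - 1)) * F (s • (ω : E))) ∂μ.toSphere := by
  have hmp := μ.measurePreserving_homeomorphUnitSphereProd
  have hG : Measurable fun q : Metric.sphere (0:E) 1 × Ioi (0:ℝ) => F ((q.2 : ℝ) • (q.1 : E)) :=
    hF.comp (by fun_prop)
  calc ∫⁻ y, F y ∂μ = ∫⁻ y : ({0}ᶜ : Set E), F y ∂(μ.comap (↑)) := by
        rw [lintegral_subtype_comap (measurableSet_singleton _).compl, restrict_compl_singleton]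
    _ = ∫⁻ q, F ((q.2 : ℝ) • (q.1 : E))
          ∂(μ.toSphere.prod (Measure.volumeIoiPow (Module.finrank ℝ E - 1))) := by
        rw [← hmp.lintegral_comp hG]
        refine lintegral_congr fun y => ?_
        congr 1
        have : ‖(y:E)‖ ≠ 0 := norm_ne_zero_iff.2 y.2
        simp [smul_smul, this]
    _ = ∫⁻ ω, ∫⁻ s : Ioi (0:ℝ), F ((s : ℝ) • (ω : E))
          ∂(Measure.volumeIoiPow (Module.finrank ℝ E - 1)) ∂μ.toSphere :=
        lintegral_prod _ hG.aemeasurable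
    _ = _ := by
        refine lintegral_congr fun ω => ?_
        have hFω : Measurable fun s : Ioi (0:ℝ) => F ((s : ℝ) • (ω : E)) :=
          hF.comp (by fun_prop)
        rw [Measure.volumeIoiPow, lintegral_withDensity_eq_lintegral_mul _ (by fun_prop) hFω]
        exact lintegral_subtype_comap measurableSet_Ioi
          (fun s : ℝ => ENNReal.ofReal (s ^ (Module.finrank ℝ E - 1)) * F (s • (ω : E)))

lemma setLIntegral_norm_preimage {E : Type*} [NormedAddCommGroup E] [NormedSpace ℝ E]
    [FiniteDimensional ℝ E] [Nontrivial E] [MeasurableSpace E] [BorelSpace E] (μ : Measure E)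
    [μ.IsAddHaarMeasure] {F : E → ENNReal} (hF : Measurable F) {T : Set ℝ} (hT : MeasurableSet T)
    (hT0 : T ⊆ Ioi 0) :
    ∫⁻ y in norm ⁻¹' T, F y ∂μ = ∫⁻ ω, (∫⁻ s in T,
      ENNReal.ofReal (s ^ (Module.finrank ℝ E - 1)) * F (s • (ω : E))) ∂μ.toSphere := by
  have hm : MeasurableSet (norm ⁻¹' T : Set E) := measurable_norm hT
  rw [← lintegral_indicator hm, lintegral_eq_lintegral_toSphere μ (hF.indicator hm)]
  refine lintegral_congr fun ω => ?_
  rw [← inter_eq_left.2 hT0, ← setLIntegral_indicator hT]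
  refine setLIntegral_congr_fun measurableSet_Ioi fun s hs => ?_
  have hs0 : 0 < s := hs
  have hn : ‖s • (ω : E)‖ = s := by
    rw [norm_smul, norm_eq_of_mem_sphere ω, mul_one, Real.norm_of_nonneg hs0.le]
  by_cases h : s ∈ T
  · simp [indicator_apply, hn, h, not_le.2 hs0]
  · simp [hn, h]

lemma measurableSet_one_le_norm_sub_and_lt_norm {E : Type*} [NormedAddCommGroup E]
    [MeasurableSpace E] [BorelSpace E] (x : E) (r : ℝ) :
    MeasurableSet {y : E | 1 ≤ ‖x - y‖ ∧ r < ‖y‖} := by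
  have h1 : IsClosed {y : E | 1 ≤ ‖x - y‖} := isClosed_le continuous_const (by fun_prop)
  have h2 : IsOpen {y : E | r < ‖y‖} := isOpen_lt continuous_const continuous_norm
  exact h1.measurableSet.inter h2.measurableSet

lemma deriv_nonpos_of_antitoneOn_Ioi {ν : ℝ → ℝ} (hanti : AntitoneOn ν (Ioi 0)) {s : ℝ}
    (hs : 0 < s) : deriv ν s ≤ 0 := by
  rw [← derivWithin_of_mem_nhds (Ioi_mem_nhds hs)]
  exact hanti.derivWithin_nonpos

lemma integrableOn_deriv_of_antitoneOn_Ioi {ν : ℝ → ℝ} (hanti : AntitoneOn ν (Ioi 0))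
    (hdiff : ∀ s, 0 < s → DifferentiableAt ℝ ν s) {u v : ℝ} (hu : 0 < u) :
    IntegrableOn (deriv ν) (Ioc u v) := by
  have h := intervalIntegral.integrableOn_deriv_of_nonneg (g := fun s => -ν s)
    (g' := fun s => -deriv ν s) (a := u) (b := v)
    (fun s hs => (hdiff s (hu.trans_le hs.1)).continuousAt.neg.continuousWithinAt)
    (fun s hs => (hdiff s (hu.trans hs.1)).hasDerivAt.neg)
    (fun s hs => neg_nonneg.2 (deriv_nonpos_of_antitoneOn_Ioi hanti (hu.trans hs.1)))
  simpa using h.neg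

lemma lintegral_neg_deriv_le {ν : ℝ → ℝ} (hpos : ∀ s, 0 < s → 0 < ν s)
    (hanti : AntitoneOn ν (Ioi 0)) (hdiff : ∀ s, 0 < s → DifferentiableAt ℝ ν s) {u v : ℝ}
    (hu : 0 < u) (huv : u ≤ v) :
    ∫⁻ s in Ioc u v, ENNReal.ofReal (-deriv ν s) ≤ ENNReal.ofReal (ν u) := by
  have hi := integrableOn_deriv_of_antitoneOn_Ioi hanti hdiff (v := v) hu
  have hi' : IntegrableOn (fun s => -deriv ν s) (Ioc u v) := hi.neg
  rw [← ofReal_integral_eq_lintegral_ofReal hi']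
  · apply ENNReal.ofReal_le_ofReal
    have hd : ∀ s ∈ uIcc u v, HasDerivAt ν (deriv ν s) s := fun s hs => by
      rw [uIcc_of_le huv] at hs
      exact (hdiff s (hu.trans_le hs.1)).hasDerivAt
    have h := intervalIntegral.integral_eq_sub_of_hasDerivAt hd
      ((intervalIntegrable_iff_integrableOn_Ioc_of_le huv).2 hi)
    rw [intervalIntegral.integral_of_le huv] at h
    rw [integral_neg, h]
    linarith [hpos v (hu.trans_le huv)]
  · filter_upwards [ae_restrict_mem measurableSet_Ioc] with s hs
    exact neg_nonneg.2 (deriv_nonpos_of_antitoneOn_Ioi hanti (hu.trans hs.1))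

/-- If `ν` is non-increasing and the weight `W` varies by at most a factor `A` over unit lengths,
then the density `-dν/ds` may be replaced by `ν` in the integral of `W`. -/
lemma lintegral_mul_neg_deriv_le {ν : ℝ → ℝ} (hpos : ∀ s, 0 < s → 0 < ν s)
    (hanti : AntitoneOn ν (Ioi 0)) (hdiff : ∀ s, 0 < s → DifferentiableAt ℝ ν s)
    {W : ℝ → ENNReal} (hW : Measurable W) {A : ENNReal}
    (hWA : ∀ s t, 1 < s → s ≤ t → t ≤ s + 1 → W s ≤ A * W t) :
    ∫⁻ s in Ioi (1:ℝ), W s * ENNReal.ofReal (-deriv ν s) ≤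
      ∫⁻ t in Ioi (1:ℝ), A * W t * ENNReal.ofReal (ν (max 1 (t - 1))) := by
  have hn : Measurable fun s => ENNReal.ofReal (-deriv ν s) := (measurable_deriv ν).neg.ennreal_ofReal
  set n : ℝ → ENNReal := fun s => ENNReal.ofReal (-deriv ν s) with hn_def
  let J : ℝ → ℝ → ENNReal := fun s t => (Ico s (s + 1)).indicator (fun t => A * W t * n s) t
  have hJ : Measurable (Function.uncurry J) := by
    have hS : MeasurableSet {q : ℝ × ℝ | q.2 ∈ Ico q.1 (q.1 + 1)} :=
      (measurableSet_le measurable_fst measurable_snd).inter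
        (measurableSet_lt measurable_snd (measurable_fst.add_const 1))
    have hm : Measurable fun q : ℝ × ℝ => A * W q.2 * n q.1 := by fun_prop
    exact hm.indicator hS
  calc ∫⁻ s in Ioi (1:ℝ), W s * n s
      ≤ ∫⁻ s in Ioi (1:ℝ), ∫⁻ t in Ioi (1:ℝ), J s t := by
        refine setLIntegral_mono' measurableSet_Ioi fun s hs => ?_
        have hs1 : (1:ℝ) < s := hs
        have hsub : Ico s (s + 1) ⊆ Ioi 1 := fun t ht => lt_of_lt_of_le hs1 ht.1
        rw [setLIntegral_indicator measurableSet_Ico, inter_eq_left.2 hsub]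
        calc W s * n s = ∫⁻ _ in Ico s (s + 1), W s * n s := by simp
          _ ≤ _ := setLIntegral_mono' measurableSet_Ico fun t ht => by
            gcongr
            exact hWA s t hs1 ht.1 ht.2.le
    _ = ∫⁻ t in Ioi (1:ℝ), ∫⁻ s in Ioi (1:ℝ), J s t :=
        lintegral_lintegral_swap hJ.aemeasurable
    _ ≤ _ := by
        refine setLIntegral_mono' measurableSet_Ioi fun t ht => ?_
        have ht1 : (1:ℝ) < t := ht
        have hJt : ∀ s, J s t = (Ioc (t - 1) t).indicator (fun s => A * W t * n s) s := fun s => by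
          simp only [J, indicator_apply]
          congr 1
          simp only [mem_Ico, mem_Ioc, eq_iff_iff]
          constructor <;> rintro ⟨h1, h2⟩ <;> constructor <;> linarith
        simp_rw [hJt]
        rw [setLIntegral_indicator measurableSet_Ioc, lintegral_const_mul _ hn]
        gcongr
        refine le_trans (lintegral_mono_set ?_) (lintegral_neg_deriv_le hpos hanti hdiff
          (u := max 1 (t - 1)) (v := t) (by positivity) (max_le ht1.le (by linarith)))
        rintro s ⟨h1, h2⟩
        exact ⟨max_lt h2 h1.1, h1.2⟩

/-- The convolution of the tail profile with itself is dominated by the profile. -/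
lemma exists_integral_tailProfile_conv_le {E : Type*} [NormedAddCommGroup E] [NormedSpace ℝ E]
    [FiniteDimensional ℝ E] [Nontrivial E] [MeasurableSpace E] [BorelSpace E] (μ : Measure E)
    [μ.IsAddHaarMeasure] {b β p : ℝ} (hb : 0 < b) (hβ : 0 < β) (hβ1 : β < 1) (hp : 0 ≤ p) :
    ∃ C : ℝ, 0 < C ∧ ∀ x : E,
      Integrable (fun y => tailProfile b β p ‖x - y‖ * tailProfile b β p ‖y‖) μ ∧
      ∫ y, tailProfile b β p ‖x - y‖ * tailProfile b β p ‖y‖ ∂μ ≤ C * tailProfile b β p ‖x‖ := by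
  have hc : 0 < b * (1 - β) := mul_pos hb (by linarith)
  have hI := integrable_exp_neg_mul_norm_rpow (E := E) μ hc hβ
  set I : ℝ := ∫ y : E, Real.exp (-(b * (1 - β)) * ‖y‖ ^ β) ∂μ with hI_def
  have hI0 : 0 ≤ I := integral_nonneg fun y => (Real.exp_pos _).le
  refine ⟨2 ^ p * (I + I + 1), by positivity, fun x => ?_⟩
  have hIx : Integrable (fun y : E => Real.exp (-(b * (1 - β)) * ‖x - y‖ ^ β)) μ :=
    hI.comp_sub_left x
  have hbd : ∀ y : E, tailProfile b β p ‖x - y‖ * tailProfile b β p ‖y‖ ≤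
      2 ^ p * tailProfile b β p ‖x‖ * (Real.exp (-(b * (1 - β)) * ‖x - y‖ ^ β) +
        Real.exp (-(b * (1 - β)) * ‖y‖ ^ β)) := fun y =>
    tailProfile_mul_le hb.le hβ.le hβ1.le hp (norm_nonneg _) (norm_nonneg _)
      (by simpa using norm_add_le (x - y) y)
  have hdom : Integrable (fun y : E => 2 ^ p * tailProfile b β p ‖x‖ *
      (Real.exp (-(b * (1 - β)) * ‖x - y‖ ^ β) + Real.exp (-(b * (1 - β)) * ‖y‖ ^ β))) μ :=
    (hIx.add hI).const_mul _
  have hint : Integrable (fun y => tailProfile b β p ‖x - y‖ * tailProfile b β p ‖y‖) μ := by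
    refine hdom.mono' ?_ (Eventually.of_forall fun y => ?_)
    · have h := continuous_tailProfile b β p
      exact (Continuous.mul (h.comp (by fun_prop)) (h.comp (by fun_prop))).aestronglyMeasurable
    · rw [Real.norm_of_nonneg (mul_pos (tailProfile_pos ..) (tailProfile_pos ..)).le]
      exact hbd y
  refine ⟨hint, (integral_mono hint hdom hbd).trans ?_⟩
  rw [integral_const_mul, integral_add hIx hI,
    integral_sub_left_eq_self (fun y : E => Real.exp (-(b * (1 - β)) * ‖y‖ ^ β)) μ x, ← hI_def]
  have h1 := tailProfile_pos b β p ‖x‖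
  have : 0 < (2:ℝ) ^ p * tailProfile b β p ‖x‖ := by positivity
  linarith
/-- The truncated second moment `K(r) = r^{-2} ∫₀^r s^{d+1} ν(s) ds`. -/
noncomputable def truncMoment (d : ℕ) (ν : ℝ → ℝ) (r : ℝ) : ℝ :=
  (∫ s in Ioo (0:ℝ) r, s ^ (d + 1) * ν s) / r ^ 2

lemma phiHat_of_le_one {d : ℕ} {ν : ℝ → ℝ} {r : ℝ} (hr : r ≤ 1) :
    phiHat d ν r = (truncMoment d ν r)⁻¹ := by
  rw [phiHat, if_pos hr, truncMoment, inv_div]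

lemma nontrivial_euclideanSpace_fin {d : ℕ} (hd : 0 < d) :
    Nontrivial (EuclideanSpace ℝ (Fin d)) :=
  Module.nontrivial_of_finrank_pos (R := ℝ) (by rwa [finrank_euclideanSpace_fin])

namespace NuAssumptions

variable {d : ℕ} {ν : ℝ → ℝ} {a b β ℓ a₃ α₃ : ℝ}

lemma integrableOn_min_mul (H : NuAssumptions d ν a b β ℓ a₃ α₃) (hd : 0 < d) :
    IntegrableOn (fun s => s ^ (d - 1) * (min 1 (s ^ 2) * ν s)) (Ioi 0) := by
  have := nontrivial_euclideanSpace_fin hd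
  have h := (integrable_fun_norm_addHaar (volume : Measure (EuclideanSpace ℝ (Fin d)))
    (f := fun s => min 1 (s ^ 2) * ν s)).1 H.ν_int
  simpa only [finrank_euclideanSpace_fin, smul_eq_mul] using h

lemma integrableOn_pow_add_one_mul (H : NuAssumptions d ν a b β ℓ a₃ α₃) (hd : 0 < d) {r : ℝ}
    (hr : r ≤ 1) : IntegrableOn (fun s => s ^ (d + 1) * ν s) (Ioo 0 r) := by
  refine ((H.integrableOn_min_mul hd).mono_set Ioo_subset_Ioi_self).congr_fun (fun s hs => ?_)
    measurableSet_Ioo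
  have h1 : s ^ 2 ≤ 1 := by have := hs.1; have := hs.2; nlinarith
  have h2 : s ^ (d + 1) = s ^ (d - 1) * s ^ 2 := by rw [← pow_add]; congr 1; omega
  simp only [min_eq_right h1, h2]
  ring

lemma integrableOn_pow_sub_one_mul (H : NuAssumptions d ν a b β ℓ a₃ α₃) (hd : 0 < d) {r : ℝ}
    (hr : 0 < r) : IntegrableOn (fun s => s ^ (d - 1) * ν s) (Ioi r) := by
  have hm : AEMeasurable ν (volume.restrict (Ioi r)) :=
    aemeasurable_restrict_of_antitoneOn measurableSet_Ioi
      (H.ν_anti.mono (Ioi_subset_Ioi hr.le))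
  have h := ((H.integrableOn_min_mul hd).mono_set (Ioi_subset_Ioi hr.le)).const_mul
    (min 1 (r ^ 2))⁻¹
  have hr2 : 0 < min 1 (r ^ 2) := by positivity
  refine Integrable.mono' h ?_ ?_
  · exact ((measurable_id.pow_const _).aemeasurable.mul hm).aestronglyMeasurable
  · filter_upwards [ae_restrict_mem measurableSet_Ioi] with s hs
    have hs0 : 0 < s := hr.trans hs
    have hν := H.ν_pos s hs0
    rw [Real.norm_of_nonneg (by positivity), le_inv_mul_iff₀ hr2]
    have h1 : min 1 (r ^ 2) ≤ min 1 (s ^ 2) := by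
      have : r ≤ s := le_of_lt hs
      gcongr
    calc min 1 (r ^ 2) * (s ^ (d - 1) * ν s) ≤ min 1 (s ^ 2) * (s ^ (d - 1) * ν s) := by gcongr
      _ = _ := by ring

/-- Monotonicity of `ν` bounds `ν(r)` by the truncated second moment. -/
lemma pow_mul_le_truncMoment (H : NuAssumptions d ν a b β ℓ a₃ α₃) (hd : 0 < d) {r : ℝ}
    (hr0 : 0 < r) (hr : r ≤ 1) : r ^ d * ν r ≤ (d + 2) * truncMoment d ν r := by
  have h1 : ∫ s in Ioo (0:ℝ) r, s ^ (d + 1) * ν r ≤ ∫ s in Ioo (0:ℝ) r, s ^ (d + 1) * ν s := by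
    refine setIntegral_mono_on ?_ (H.integrableOn_pow_add_one_mul hd hr) measurableSet_Ioo
      fun s hs => ?_
    · exact ((continuous_pow (d + 1)).mul continuous_const).integrableOn_Icc.mono_set
        Ioo_subset_Icc_self
    · have := hs.1
      have := H.ν_anti hs.1 hr0 hs.2.le
      gcongr
  have h2 : ∫ s in Ioo (0:ℝ) r, s ^ (d + 1) * ν r = r ^ (d + 2) / (d + 2) * ν r := by
    rw [← integral_Ioc_eq_integral_Ioo, ← intervalIntegral.integral_of_le hr0.le,
      intervalIntegral.integral_mul_const, integral_pow]
    push_cast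
    simp
    left
    ring
  rw [h2] at h1
  rw [truncMoment, mul_div_assoc', le_div_iff₀ (by positivity)]
  have hd2 : (0:ℝ) < d + 2 := by positivity
  calc r ^ d * ν r * r ^ 2 = (d + 2) * (r ^ (d + 2) / (d + 2) * ν r) := by field_simp; ring
    _ ≤ _ := by gcongr

lemma truncMoment_pos (H : NuAssumptions d ν a b β ℓ a₃ α₃) (hd : 0 < d) {r : ℝ}
    (hr0 : 0 < r) (hr : r ≤ 1) : 0 < truncMoment d ν r := by
  have h := H.pow_mul_le_truncMoment hd hr0 hr
  have hν := H.ν_pos r hr0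
  have h1 : 0 < r ^ d * ν r := by positivity
  have hd2 : (0:ℝ) < d + 2 := by positivity
  exact pos_of_mul_pos_right (h1.trans_le h) hd2.le

lemma truncMoment_scaling (H : NuAssumptions d ν a b β ℓ a₃ α₃) (hd : 0 < d) {r s : ℝ}
    (hr0 : 0 < r) (hrs : r ≤ s) (hs : s ≤ 1) :
    a₃ * (s / r) ^ α₃ * truncMoment d ν s ≤ truncMoment d ν r := by
  have h := H.hN2 r s hr0 hrs
  have hs0 := hr0.trans_le hrs
  rw [phiHat_of_le_one hs, phiHat_of_le_one (hrs.trans hs), div_inv_eq_mul, inv_mul_eq_div,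
    le_div_iff₀ (H.truncMoment_pos hd hs0 hs)] at h
  exact h

lemma truncMoment_one_le (H : NuAssumptions d ν a b β ℓ a₃ α₃) (hd : 0 < d) {r : ℝ}
    (hr0 : 0 < r) (hr : r ≤ 1) : a₃ * truncMoment d ν 1 ≤ truncMoment d ν r := by
  refine le_trans ?_ (H.truncMoment_scaling hd hr0 hr le_rfl)
  have h1 := H.truncMoment_pos hd one_pos le_rfl
  have h2 : 1 ≤ (1 / r) ^ α₃ := Real.one_le_rpow (by rwa [le_div_iff₀ hr0, one_mul]) H.α₃_pos.le
  have h3 := H.a₃_pos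
  calc a₃ * truncMoment d ν 1 = a₃ * 1 * truncMoment d ν 1 := by ring
    _ ≤ _ := by gcongr

/-- The radial tail mass is dominated by the truncated second moment. -/
lemma exists_integral_tail_le (H : NuAssumptions d ν a b β ℓ a₃ α₃) (hd : 0 < d) :
    ∃ C : ℝ, 0 < C ∧ ∀ r : ℝ, 0 < r → r ≤ 1 →
      ∫ s in Ioi r, s ^ (d - 1) * ν s ≤ C * truncMoment d ν r := by
  set T : ℝ := ∫ s in Ioi (1:ℝ), s ^ (d - 1) * ν s with hT
  have ha₃ := H.a₃_pos
  have hα := H.α₃_pos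
  have hK1 := H.truncMoment_pos hd one_pos le_rfl
  have hT0 : 0 ≤ T := setIntegral_nonneg measurableSet_Ioi fun s hs => by
    have h0 : 0 < s := one_pos.trans hs
    have := H.ν_pos s h0
    positivity
  refine ⟨(d + 2) / (a₃ * α₃) + T / (a₃ * truncMoment d ν 1), by positivity, fun r hr0 hr => ?_⟩
  have hKr := H.truncMoment_pos hd hr0 hr
  have hi := H.integrableOn_pow_sub_one_mul hd hr0
  have hsplit : ∫ s in Ioi r, s ^ (d - 1) * ν s =
      (∫ s in Ioc r 1, s ^ (d - 1) * ν s) + T := by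
    rw [hT, ← setIntegral_union (by
      rw [Set.disjoint_left]; intro s h1 h2; exact absurd h1.2 (not_le.2 h2)) measurableSet_Ioi
      (hi.mono_set Ioc_subset_Ioi_self) (hi.mono_set (Ioi_subset_Ioi hr)), Ioc_union_Ioi_eq_Ioi hr]
  have hTle : T ≤ T / (a₃ * truncMoment d ν 1) * truncMoment d ν r := by
    rw [div_mul_eq_mul_div, le_div_iff₀ (by positivity)]
    exact mul_le_mul_of_nonneg_left (H.truncMoment_one_le hd hr0 hr) hT0
  have hα1 : -1 - α₃ < -1 := by linarith
  have hnear : ∫ s in Ioc r 1, s ^ (d - 1) * ν s ≤ (d + 2) / (a₃ * α₃) * truncMoment d ν r := by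
    have hg : IntegrableOn (fun s : ℝ => (d + 2) / a₃ * truncMoment d ν r * r ^ α₃ *
        s ^ (-1 - α₃)) (Ioi r) := (integrableOn_Ioi_rpow_of_lt hα1 hr0).const_mul _
    calc ∫ s in Ioc r 1, s ^ (d - 1) * ν s
        ≤ ∫ s in Ioc r 1, (d + 2) / a₃ * truncMoment d ν r * r ^ α₃ * s ^ (-1 - α₃) := by
          refine setIntegral_mono_on (hi.mono_set Ioc_subset_Ioi_self)
            (hg.mono_set Ioc_subset_Ioi_self) measurableSet_Ioc fun s hs => ?_
          have hs0 : 0 < s := hr0.trans hs.1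
          have h1 := H.pow_mul_le_truncMoment hd hs0 hs.2
          have h2 := H.truncMoment_scaling hd hr0 hs.1.le hs.2
          have h3 : s ^ d = s * s ^ (d - 1) := by rw [← pow_succ']; congr 1; omega
          have h4 : s ^ (-1 - α₃) = (s * s ^ α₃)⁻¹ := by
            rw [show -1 - α₃ = -(1 + α₃) by ring, Real.rpow_neg hs0.le, Real.rpow_add hs0,
              Real.rpow_one]
          rw [Real.div_rpow hs0.le hr0.le] at h2
          have hsα : 0 < s ^ α₃ := Real.rpow_pos_of_pos hs0 _
          have hrα : 0 < r ^ α₃ := Real.rpow_pos_of_pos hr0 _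
          have h5 : truncMoment d ν s ≤ truncMoment d ν r * r ^ α₃ / (a₃ * s ^ α₃) := by
            rw [le_div_iff₀ (by positivity)]
            calc _ = a₃ * (s ^ α₃ / r ^ α₃) * truncMoment d ν s * r ^ α₃ := by field_simp
              _ ≤ _ := by gcongr
          rw [h3] at h1
          calc s ^ (d - 1) * ν s = (s * s ^ (d - 1) * ν s) / s := by field_simp
            _ ≤ ((d + 2) * (truncMoment d ν r * r ^ α₃ / (a₃ * s ^ α₃))) / s :=
              div_le_div_of_nonneg_right (h1.trans (by gcongr)) hs0.le
            _ = _ := by rw [h4]; field_simp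
      _ ≤ ∫ s in Ioi r, (d + 2) / a₃ * truncMoment d ν r * r ^ α₃ * s ^ (-1 - α₃) := by
          refine setIntegral_mono_set hg ?_ (Eventually.of_forall Ioc_subset_Ioi_self)
          filter_upwards [ae_restrict_mem measurableSet_Ioi] with s hs
          have hs0 : 0 < s := hr0.trans hs
          simp only [Pi.zero_apply]
          positivity
      _ = _ := by
          rw [integral_const_mul, integral_Ioi_rpow_of_lt hα1 hr0,
            show -1 - α₃ + 1 = -α₃ by ring, Real.rpow_neg hr0.le]
          have hrα : 0 < r ^ α₃ := Real.rpow_pos_of_pos hr0 _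
          field_simp
  rw [hsplit, add_mul]
  linarith

lemma aestronglyMeasurable_norm (H : NuAssumptions d ν a b β ℓ a₃ α₃) (hd : 0 < d) :
    AEStronglyMeasurable (fun z : EuclideanSpace ℝ (Fin d) => ν ‖z‖) := by
  have := nontrivial_euclideanSpace_fin hd
  have hm : Continuous fun z : EuclideanSpace ℝ (Fin d) => min 1 (‖z‖ ^ 2) := by fun_prop
  refine (hm.measurable.inv.aestronglyMeasurable.mul H.ν_int.aestronglyMeasurable).congr ?_
  filter_upwards [compl_mem_ae_iff.2 (measure_singleton (0 : EuclideanSpace ℝ (Fin d)))] with z hz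
  have h0 : 0 < ‖z‖ := norm_pos_iff.2 hz
  have h1 : min 1 (‖z‖ ^ 2) ≠ 0 := by positivity
  simp only [Pi.mul_apply, Pi.inv_apply]
  rw [inv_mul_cancel_left₀ h1]

lemma one_sub_cos_mul_nonneg (H : NuAssumptions d ν a b β ℓ a₃ α₃) (hd : 0 < d) (ρ : ℝ)
    (z : EuclideanSpace ℝ (Fin d)) : 0 ≤ (1 - Real.cos (ρ * z ⟨0, hd⟩)) * ν ‖z‖ := by
  rcases eq_or_ne z 0 with rfl | hz
  · simp
  · exact mul_nonneg (sub_nonneg.2 (Real.cos_le_one _)) (H.ν_pos _ (norm_pos_iff.2 hz)).le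

lemma one_sub_cos_mul_le (H : NuAssumptions d ν a b β ℓ a₃ α₃) (hd : 0 < d) {ρ R : ℝ}
    (hρ : 0 ≤ ρ) (hR : ρ ≤ R) (z : EuclideanSpace ℝ (Fin d)) :
    (1 - Real.cos (ρ * z ⟨0, hd⟩)) * ν ‖z‖ ≤ (2 + R ^ 2) * (min 1 (‖z‖ ^ 2) * ν ‖z‖) := by
  rcases eq_or_ne z 0 with rfl | hz
  · simp
  have hν := (H.ν_pos _ (norm_pos_iff.2 hz)).le
  rw [← mul_assoc]
  refine mul_le_mul_of_nonneg_right ?_ hν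
  rcases le_total 1 (‖z‖ ^ 2) with h | h
  · rw [min_eq_left h]
    nlinarith [Real.neg_one_le_cos (ρ * z ⟨0, hd⟩), sq_nonneg R]
  · rw [min_eq_right h]
    have h1 := Real.one_sub_sq_div_two_le_cos (x := ρ * z ⟨0, hd⟩)
    have h2 : (z ⟨0, hd⟩) ^ 2 ≤ ‖z‖ ^ 2 := by
      rw [← sq_abs]
      exact pow_le_pow_left₀ (abs_nonneg _) (PiLp.norm_apply_le z _) 2
    have h3 : ρ ^ 2 ≤ R ^ 2 := pow_le_pow_left₀ hρ hR 2
    have h4 : (ρ * z ⟨0, hd⟩) ^ 2 ≤ R ^ 2 * ‖z‖ ^ 2 := by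
      rw [mul_pow]
      gcongr
    nlinarith [sq_nonneg ‖z‖, sq_nonneg (ρ * z ⟨0, hd⟩)]

lemma integrable_one_sub_cos_mul (H : NuAssumptions d ν a b β ℓ a₃ α₃) (hd : 0 < d) {ρ : ℝ}
    (hρ : 0 ≤ ρ) :
    Integrable fun z : EuclideanSpace ℝ (Fin d) => (1 - Real.cos (ρ * z ⟨0, hd⟩)) * ν ‖z‖ := by
  refine (H.ν_int.const_mul (2 + ρ ^ 2)).mono' ?_ (Eventually.of_forall fun z => ?_)
  · have hc : Continuous fun z : EuclideanSpace ℝ (Fin d) => 1 - Real.cos (ρ * z ⟨0, hd⟩) := by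
      fun_prop
    exact hc.aestronglyMeasurable.mul (H.aestronglyMeasurable_norm hd)
  · rw [Real.norm_of_nonneg (H.one_sub_cos_mul_nonneg hd ρ z)]
    exact H.one_sub_cos_mul_le hd hρ le_rfl z

lemma psi_le_Psi (H : NuAssumptions d ν a b β ℓ a₃ α₃) (hd : 0 < d) {R : ℝ} (hR : 0 < R) :
    psi d hd ν R ≤ Psi d hd ν R := by
  refine le_csSup ⟨∫ z : EuclideanSpace ℝ (Fin d), (2 + R ^ 2) * (min 1 (‖z‖ ^ 2) * ν ‖z‖), ?_⟩
    (mem_image_of_mem _ ⟨hR, le_rfl⟩)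
  rintro _ ⟨ρ, hρ, rfl⟩
  exact integral_mono (H.integrable_one_sub_cos_mul hd hρ.1.le) (H.ν_int.const_mul _)
    fun z => H.one_sub_cos_mul_le hd hρ.1.le hρ.2 z

end NuAssumptions

/-- Coordinates are exchangeable under rotation invariant weights. -/
lemma integral_sq_coord_mul_norm {d : ℕ} (g : ℝ → ℝ) (i j : Fin d) :
    ∫ z : EuclideanSpace ℝ (Fin d), (z i) ^ 2 * g ‖z‖ =
      ∫ z : EuclideanSpace ℝ (Fin d), (z j) ^ 2 * g ‖z‖ := by
  let e : EuclideanSpace ℝ (Fin d) ≃ₗᵢ[ℝ] EuclideanSpace ℝ (Fin d) :=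
    LinearIsometryEquiv.piLpCongrLeft 2 ℝ ℝ (Equiv.swap i j)
  have h := e.measurePreserving.integral_comp e.toHomeomorph.measurableEmbedding
    (fun z => (z j) ^ 2 * g ‖z‖)
  rw [← h]
  refine integral_congr_ae (Eventually.of_forall fun z => ?_)
  simp [e, LinearIsometryEquiv.piLpCongrLeft_apply, Equiv.piCongrLeft'_apply]

namespace NuAssumptions

variable {d : ℕ} {ν : ℝ → ℝ} {a b β ℓ a₃ α₃ : ℝ}

/-- The truncated second moment is dominated by the characteristic exponent. -/
lemma exists_truncMoment_le_Psi (H : NuAssumptions d ν a b β ℓ a₃ α₃) (hd : 0 < d) :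
    ∃ C : ℝ, 0 < C ∧ ∀ r : ℝ, 0 < r → r ≤ 1 → truncMoment d ν r ≤ C * Psi d hd ν (1 / r) := by
  have := nontrivial_euclideanSpace_fin hd
  set V : ℝ := (volume : Measure (EuclideanSpace ℝ (Fin d))).real (Metric.ball 0 1) with hV
  have hV0 : 0 < V := ENNReal.toReal_pos (Metric.measure_ball_pos _ _ one_pos).ne'
    measure_ball_lt_top.ne
  have hπ := Real.pi_pos
  refine ⟨(2 / Real.pi ^ 2 * V)⁻¹, by positivity, fun r hr0 hr => ?_⟩
  rw [le_inv_mul_iff₀ (by positivity)]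
  refine le_trans ?_ (H.psi_le_Psi hd (by positivity))
  set g : ℝ → ℝ := (Iio r).indicator ν with hg
  have hgr : ∀ s ∈ Ioi (0:ℝ), s ^ (d - 1) • (s ^ 2 * g s) =
      (Ioo (0:ℝ) r).indicator (fun s => s ^ (d + 1) * ν s) s := fun s hs => by
    have h2 : s ^ (d + 1) = s ^ (d - 1) * s ^ 2 := by rw [← pow_add]; congr 1; omega
    have hs0 : 0 < s := hs
    by_cases h : s < r
    · simp [hg, h, hs0, h2]; ring
    · simp [hg, h]
  have hsub : Ioi (0:ℝ) ∩ Ioo 0 r = Ioo 0 r := inter_eq_right.2 Ioo_subset_Ioi_self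
  have hradial : ∫ z : EuclideanSpace ℝ (Fin d), ‖z‖ ^ 2 * g ‖z‖ =
      d * (V * ∫ s in Ioo (0:ℝ) r, s ^ (d + 1) * ν s) := by
    rw [integral_fun_norm_addHaar volume (fun s => s ^ 2 * g s), finrank_euclideanSpace_fin,
      setIntegral_congr_fun measurableSet_Ioi hgr, setIntegral_indicator measurableSet_Ioo, hsub,
      nsmul_eq_mul, smul_eq_mul]
  have hint : Integrable fun z : EuclideanSpace ℝ (Fin d) => ‖z‖ ^ 2 * g ‖z‖ := by
    rw [integrable_fun_norm_addHaar volume (f := fun s => s ^ 2 * g s), finrank_euclideanSpace_fin,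
      integrableOn_congr_fun hgr measurableSet_Ioi, IntegrableOn,
      integrable_indicator_iff measurableSet_Ioo, IntegrableOn, Measure.restrict_restrict
      measurableSet_Ioo, inter_comm, hsub]
    exact H.integrableOn_pow_add_one_mul hd hr
  have hgnn : ∀ z : EuclideanSpace ℝ (Fin d), z ≠ 0 → 0 ≤ g ‖z‖ := fun z hz =>
    indicator_apply_nonneg fun _ => (H.ν_pos _ (norm_pos_iff.2 hz)).le
  have hgm : AEStronglyMeasurable fun z : EuclideanSpace ℝ (Fin d) => g ‖z‖ := by
    have hset : MeasurableSet {z : EuclideanSpace ℝ (Fin d) | ‖z‖ ∈ Iio r} :=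
      measurableSet_lt measurable_norm measurable_const
    exact (H.aestronglyMeasurable_norm hd).indicator hset
  have hcoord : ∀ i : Fin d,
      Integrable fun z : EuclideanSpace ℝ (Fin d) => (z i) ^ 2 * g ‖z‖ := fun i => by
    refine hint.mono' ?_ (Eventually.of_forall fun z => ?_)
    · have hc : Continuous fun z : EuclideanSpace ℝ (Fin d) => (z i) ^ 2 := by fun_prop
      exact hc.aestronglyMeasurable.mul hgm
    · rcases eq_or_ne z 0 with rfl | hz
      · simp
      · rw [Real.norm_of_nonneg (mul_nonneg (sq_nonneg _) (hgnn z hz))]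
        refine mul_le_mul_of_nonneg_right ?_ (hgnn z hz)
        rw [← sq_abs]
        exact pow_le_pow_left₀ (abs_nonneg _) (PiLp.norm_apply_le z _) 2
  have hsum : ∫ z : EuclideanSpace ℝ (Fin d), ‖z‖ ^ 2 * g ‖z‖ =
      d * ∫ z : EuclideanSpace ℝ (Fin d), (z ⟨0, hd⟩) ^ 2 * g ‖z‖ := by
    have h1 : ∀ z : EuclideanSpace ℝ (Fin d), ‖z‖ ^ 2 * g ‖z‖ = ∑ i, (z i) ^ 2 * g ‖z‖ :=
      fun z => by rw [EuclideanSpace.real_norm_sq_eq, Finset.sum_mul]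
    simp_rw [h1]
    rw [integral_finsetSum _ fun i _ => hcoord i,
      Finset.sum_congr rfl fun i _ => integral_sq_coord_mul_norm g i ⟨0, hd⟩]
    simp
  have hdpos : (0:ℝ) < d := by exact_mod_cast hd
  have hmom : ∫ z : EuclideanSpace ℝ (Fin d), (z ⟨0, hd⟩) ^ 2 * g ‖z‖ =
      V * ∫ s in Ioo (0:ℝ) r, s ^ (d + 1) * ν s :=
    mul_left_cancel₀ hdpos.ne' (hsum.symm.trans hradial)
  calc 2 / Real.pi ^ 2 * V * truncMoment d ν r
      = ∫ z : EuclideanSpace ℝ (Fin d),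
          2 / Real.pi ^ 2 / r ^ 2 * ((z ⟨0, hd⟩) ^ 2 * g ‖z‖) := by
        rw [integral_const_mul, hmom, truncMoment]
        ring
    _ ≤ psi d hd ν (1 / r) := by
        refine integral_mono ((hcoord _).const_mul _)
          (H.integrable_one_sub_cos_mul hd (by positivity)) fun z => ?_
        by_cases hz : ‖z‖ < r
        · rcases eq_or_ne z 0 with rfl | hz0
          · simp
          have hν := (H.ν_pos _ (norm_pos_iff.2 hz0)).le
          have hcos := Real.cos_le_one_sub_mul_cos_sq (x := 1 / r * z ⟨0, hd⟩) (by
            rw [abs_mul, abs_of_pos (by positivity : 0 < 1 / r), one_div, inv_mul_le_iff₀ hr0]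
            have h1 : |z ⟨0, hd⟩| ≤ ‖z‖ := PiLp.norm_apply_le z _
            nlinarith [Real.pi_gt_three])
          have hgz : g ‖z‖ = ν ‖z‖ := indicator_of_mem (by exact hz) _
          simp only [hgz]
          rw [← mul_assoc]
          refine mul_le_mul_of_nonneg_right ?_ hν
          calc _ = 2 / Real.pi ^ 2 * (1 / r * z ⟨0, hd⟩) ^ 2 := by field_simp
            _ ≤ _ := by linarith
        · have hgz : g ‖z‖ = 0 := indicator_of_notMem (by exact hz) _
          simp only [hgz, mul_zero]
          exact H.one_sub_cos_mul_nonneg hd _ z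

lemma ν_le_tailProfile (H : NuAssumptions d ν a b β ℓ a₃ α₃) {s : ℝ} (hs : 1 < s) :
    ν s ≤ a * tailProfile b β ℓ s := by
  rw [tailProfile_of_one_le hs.le, ← mul_assoc]
  exact H.hN1 s hs

lemma exists_ν_shift_le_tailProfile (H : NuAssumptions d ν a b β ℓ a₃ α₃) :
    ∃ C : ℝ, 0 < C ∧ ∀ t : ℝ, 1 < t → ν (max 1 (t - 1)) ≤ C * tailProfile b β ℓ t := by
  have ha := H.ha
  have hν := H.ν_pos 1 one_pos
  refine ⟨(a + ν 1 * Real.exp b) * (2 ^ ℓ * Real.exp b), by positivity, fun t ht => ?_⟩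
  have key : ∀ s, |s - t| ≤ 1 → tailProfile b β ℓ s ≤
      2 ^ ℓ * Real.exp b * tailProfile b β ℓ t := fun s hs =>
    tailProfile_le_of_abs_sub_le H.hb.le H.β_pos.le H.β_le H.ℓ_nonneg hs
  have hp := tailProfile_pos b β ℓ t
  rcases le_or_gt (t - 1) 1 with h | h
  · rw [max_eq_left h]
    have h1 := key 1 (abs_le.2 ⟨by linarith, by linarith⟩)
    have h2 : tailProfile b β ℓ 1 = (Real.exp b)⁻¹ := by
      rw [tailProfile_of_one_le le_rfl, Real.one_rpow, Real.one_rpow, ← Real.exp_neg]; simp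
    rw [h2, inv_le_iff_one_le_mul₀ (Real.exp_pos b)] at h1
    calc ν 1 = ν 1 * 1 := (mul_one _).symm
      _ ≤ ν 1 * (2 ^ ℓ * Real.exp b * tailProfile b β ℓ t * Real.exp b) := by gcongr
      _ = ν 1 * Real.exp b * (2 ^ ℓ * Real.exp b) * tailProfile b β ℓ t := by ring
      _ ≤ _ := by gcongr; linarith
  · rw [max_eq_right h.le]
    calc ν (t - 1) ≤ a * tailProfile b β ℓ (t - 1) := H.ν_le_tailProfile h
      _ ≤ a * (2 ^ ℓ * Real.exp b * tailProfile b β ℓ t) := by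
        gcongr
        exact key (t - 1) (by simp)
      _ = a * (2 ^ ℓ * Real.exp b) * tailProfile b β ℓ t := by ring
      _ ≤ _ := by
        gcongr
        have := Real.exp_pos b
        nlinarith [mul_pos hν this]

lemma integrable_tail (H : NuAssumptions d ν a b β ℓ a₃ α₃) (hd : 0 < d) {r : ℝ} (hr0 : 0 < r) :
    Integrable fun y : EuclideanSpace ℝ (Fin d) => (Ioi r).indicator ν ‖y‖ := by
  have := nontrivial_euclideanSpace_fin hd
  rw [integrable_fun_norm_addHaar volume (f := (Ioi r).indicator ν), finrank_euclideanSpace_fin]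
  have h : (fun s : ℝ => s ^ (d - 1) • (Ioi r).indicator ν s) =
      (Ioi r).indicator fun s => s ^ (d - 1) * ν s := by
    ext s
    simp only [indicator_apply, smul_eq_mul]
    split_ifs <;> simp
  rw [h]
  exact ((integrable_indicator_iff measurableSet_Ioi).2
    (H.integrableOn_pow_sub_one_mul hd hr0)).integrableOn

/-- The mass of `ν` outside a ball is dominated by the truncated second moment. -/
lemma exists_integral_norm_tail_le (H : NuAssumptions d ν a b β ℓ a₃ α₃) (hd : 0 < d) :
    ∃ C : ℝ, 0 < C ∧ ∀ r : ℝ, 0 < r → r ≤ 1 →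
      ∫ y : EuclideanSpace ℝ (Fin d), (Ioi r).indicator ν ‖y‖ ≤ C * truncMoment d ν r := by
  have := nontrivial_euclideanSpace_fin hd
  obtain ⟨C, hC, hCle⟩ := H.exists_integral_tail_le hd
  set V : ℝ := (volume : Measure (EuclideanSpace ℝ (Fin d))).real (Metric.ball 0 1) with hV
  have hV0 : 0 < V := ENNReal.toReal_pos (Metric.measure_ball_pos _ _ one_pos).ne'
    measure_ball_lt_top.ne
  have hdpos : (0:ℝ) < d := by exact_mod_cast hd
  refine ⟨d * (V * C), by positivity, fun r hr0 hr => ?_⟩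
  have h : (fun s : ℝ => s ^ (d - 1) • (Ioi r).indicator ν s) =
      (Ioi r).indicator fun s => s ^ (d - 1) * ν s := by
    ext s
    simp only [indicator_apply, smul_eq_mul]
    split_ifs <;> simp
  rw [integral_fun_norm_addHaar volume ((Ioi r).indicator ν), finrank_euclideanSpace_fin, h,
    setIntegral_indicator measurableSet_Ioi, inter_eq_right.2 (Ioi_subset_Ioi hr0.le),
    nsmul_eq_mul, smul_eq_mul]
  calc (d:ℝ) * (V * ∫ s in Ioi r, s ^ (d - 1) * ν s)
      ≤ d * (V * (C * truncMoment d ν r)) := by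
        gcongr
        exact hCle r hr0 hr
    _ = _ := by ring

lemma ftil_nonneg (H : NuAssumptions d ν a b β ℓ a₃ α₃) (hd : 0 < d) {s : ℝ} (hs : 1 ≤ s) :
    0 ≤ ftil d ν b β ℓ s := by
  have hK := H.truncMoment_pos hd one_pos le_rfl
  unfold ftil
  split_ifs with h
  · obtain rfl : s = 1 := le_antisymm h hs
    rw [phiHat_of_le_one le_rfl]
    positivity
  · positivity

lemma ffun_nonneg (H : NuAssumptions d ν a b β ℓ a₃ α₃) (hd : 0 < d) {s : ℝ} (hs : 1 ≤ s) :
    0 ≤ ffun d ν b β ℓ s := by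
  have hK := H.truncMoment_pos hd one_pos le_rfl
  unfold ffun
  split_ifs with h
  · obtain rfl : s = 1 := le_antisymm h hs
    rw [phiHat_of_le_one le_rfl]
    positivity
  · positivity

lemma ftil_le_tailProfile (H : NuAssumptions d ν a b β ℓ a₃ α₃) {s : ℝ} (hs : 1 ≤ s) :
    ftil d ν b β ℓ s ≤ Real.exp b * tailProfile b β ℓ s := by
  have hb := Real.one_le_exp H.hb.le
  rw [tailProfile_of_one_le hs, ftil]
  split_ifs with h
  · obtain rfl : s = 1 := le_antisymm h hs
    have h1 : Real.exp b * ((1:ℝ) ^ (-ℓ) * Real.exp (-b * (1:ℝ) ^ β)) = 1 := by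
      rw [Real.one_rpow, Real.one_rpow, one_mul, ← Real.exp_add]; simp
    rw [h1, one_pow, one_mul]
    exact div_self_le_one _
  · exact le_mul_of_one_le_left (by positivity) hb

lemma ffun_le_tailProfile (H : NuAssumptions d ν a b β ℓ a₃ α₃) {s : ℝ} (hs : 1 ≤ s) :
    ffun d ν b β ℓ s ≤ Real.exp b * tailProfile b β (ℓ + 1) s := by
  have hb := Real.one_le_exp H.hb.le
  rw [tailProfile_of_one_le hs, ffun]
  split_ifs with h
  · obtain rfl : s = 1 := le_antisymm h hs
    have h1 : Real.exp b * ((1:ℝ) ^ (-(ℓ + 1)) * Real.exp (-b * (1:ℝ) ^ β)) = 1 := by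
      rw [Real.one_rpow, Real.one_rpow, one_mul, ← Real.exp_add]; simp
    rw [h1, one_pow, one_mul]
    exact div_self_le_one _
  · rw [show -(ℓ + 1) = -ℓ - 1 by ring]
    exact le_mul_of_one_le_left (by positivity) hb

lemma exists_setIntegral_ftil_mul_le (H : NuAssumptions d ν a b β ℓ a₃ α₃) (hd : 0 < d)
    (hβ1 : β < 1) :
    ∃ C : ℝ, 0 < C ∧ ∀ x : EuclideanSpace ℝ (Fin d), ∀ r : ℝ, 0 < r → r ≤ 1 →
      ∫ y in {y : EuclideanSpace ℝ (Fin d) | 1 ≤ ‖x - y‖ ∧ r < ‖y‖},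
        ftil d ν b β ℓ ‖x - y‖ * ν ‖y‖ ≤ C * truncMoment d ν r * tailProfile b β ℓ ‖x‖ := by
  have := nontrivial_euclideanSpace_fin hd
  obtain ⟨C₁, hC₁, hC₁le⟩ := H.exists_integral_norm_tail_le hd
  obtain ⟨C₂, hC₂, hC₂le⟩ := exists_integral_tailProfile_conv_le
    (volume : Measure (EuclideanSpace ℝ (Fin d))) H.hb H.β_pos hβ1 H.ℓ_nonneg
  have ha := H.ha
  have ha₃ := H.a₃_pos
  have hK1 := H.truncMoment_pos hd one_pos le_rfl
  set A : ℝ := 2 ^ ℓ * Real.exp b with hA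
  have hA0 : 0 < A := by positivity
  refine ⟨Real.exp b * (A * C₁ + a * C₂ / (a₃ * truncMoment d ν 1)), by positivity,
    fun x r hr0 hr => ?_⟩
  obtain ⟨hconv, hconvle⟩ := hC₂le x
  have htail := H.integrable_tail hd hr0
  have hK := H.truncMoment_pos hd hr0 hr
  have hx := tailProfile_pos b β ℓ ‖x‖
  set G : EuclideanSpace ℝ (Fin d) → ℝ := fun y =>
    Real.exp b * (A * tailProfile b β ℓ ‖x‖ * (Ioi r).indicator ν ‖y‖ +
      a * (tailProfile b β ℓ ‖x - y‖ * tailProfile b β ℓ ‖y‖)) with hG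
  have hGint : Integrable G := ((htail.const_mul _).add (hconv.const_mul _)).const_mul _
  have hind : ∀ y : EuclideanSpace ℝ (Fin d), 0 ≤ (Ioi r).indicator ν ‖y‖ := fun y =>
    indicator_apply_nonneg fun h => (H.ν_pos _ (hr0.trans h)).le
  have htp : ∀ y : EuclideanSpace ℝ (Fin d),
      0 < tailProfile b β ℓ ‖x - y‖ * tailProfile b β ℓ ‖y‖ := fun y =>
    mul_pos (tailProfile_pos ..) (tailProfile_pos ..)
  have hG0 : ∀ y, 0 ≤ G y := fun y => by
    have := hind y
    have := htp y
    positivity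
  have hS : MeasurableSet {y : EuclideanSpace ℝ (Fin d) | 1 ≤ ‖x - y‖ ∧ r < ‖y‖} :=
    measurableSet_one_le_norm_sub_and_lt_norm x r
  have hle : ∫ y in {y : EuclideanSpace ℝ (Fin d) | 1 ≤ ‖x - y‖ ∧ r < ‖y‖},
      ftil d ν b β ℓ ‖x - y‖ * ν ‖y‖ ≤ ∫ y, G y := by
    refine (integral_mono_of_nonneg ?_ hGint.integrableOn ?_).trans
      (setIntegral_le_integral hGint (Eventually.of_forall hG0))
    · filter_upwards [ae_restrict_mem hS] with y hy
      exact mul_nonneg (H.ftil_nonneg hd hy.1) (H.ν_pos _ (hr0.trans hy.2)).le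
    · filter_upwards [ae_restrict_mem hS] with y hy
      have hν := (H.ν_pos _ (hr0.trans hy.2)).le
      have h1 : ftil d ν b β ℓ ‖x - y‖ * ν ‖y‖ ≤
          Real.exp b * (tailProfile b β ℓ ‖x - y‖ * ν ‖y‖) := by
        rw [← mul_assoc]
        exact mul_le_mul_of_nonneg_right (H.ftil_le_tailProfile hy.1) hν
      refine h1.trans (mul_le_mul_of_nonneg_left ?_ (Real.exp_pos b).le)
      have hry : (Ioi r).indicator ν ‖y‖ = ν ‖y‖ := indicator_of_mem (by exact hy.2) _
      rcases le_or_gt ‖y‖ 1 with h | h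
      · have h2 : tailProfile b β ℓ ‖x - y‖ ≤ A * tailProfile b β ℓ ‖x‖ :=
          tailProfile_le_of_abs_sub_le H.hb.le H.β_pos.le H.β_le H.ℓ_nonneg
            ((abs_norm_sub_norm_le _ _).trans (by simpa using h))
        rw [hry]
        have := mul_le_mul_of_nonneg_right h2 hν
        have := mul_pos ha (htp y)
        linarith
      · have h2 := mul_le_mul_of_nonneg_left (H.ν_le_tailProfile h)
          (tailProfile_pos b β ℓ ‖x - y‖).le
        have h3 : 0 ≤ A * tailProfile b β ℓ ‖x‖ * (Ioi r).indicator ν ‖y‖ :=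
          mul_nonneg (by positivity) (hind y)
        linarith
  refine hle.trans ?_
  rw [hG, integral_const_mul, integral_add (htail.const_mul _) (hconv.const_mul _),
    integral_const_mul, integral_const_mul]
  have h1 := hC₁le r hr0 hr
  have h2 := H.truncMoment_one_le hd hr0 hr
  have h3 : 1 ≤ truncMoment d ν r / (a₃ * truncMoment d ν 1) := by
    rwa [le_div_iff₀ (by positivity), one_mul]
  calc _ ≤ Real.exp b * (A * tailProfile b β ℓ ‖x‖ * (C₁ * truncMoment d ν r) +
        a * (C₂ * tailProfile b β ℓ ‖x‖) * 1) := by rw [mul_one]; gcongr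
    _ ≤ Real.exp b * (A * tailProfile b β ℓ ‖x‖ * (C₁ * truncMoment d ν r) +
        a * (C₂ * tailProfile b β ℓ ‖x‖) *
          (truncMoment d ν r / (a₃ * truncMoment d ν 1))) := by gcongr
    _ = _ := by field_simp

lemma nu1_nonneg (H : NuAssumptions d ν a b β ℓ a₃ α₃) {s : ℝ} (hs : 0 < s) : 0 ≤ nu1 ν s :=
  div_nonneg (neg_nonneg.2 (deriv_nonpos_of_antitoneOn_Ioi H.ν_anti hs))
    (by have := Real.pi_pos; positivity)

lemma pow_succ_mul_nu1_le (H : NuAssumptions d ν a b β ℓ a₃ α₃) {s : ℝ} (hs : 0 < s) :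
    s ^ (d + 1) * nu1 ν s ≤ s ^ d * -deriv ν s := by
  have h := neg_nonneg.2 (deriv_nonpos_of_antitoneOn_Ioi H.ν_anti hs)
  have hπ := Real.pi_gt_three
  have h1 : s ^ (d + 1) * nu1 ν s = s ^ d * (-deriv ν s) / (2 * Real.pi) := by
    rw [nu1, pow_succ]
    field_simp
  rw [h1]
  exact div_le_self (by positivity) (by linarith)

lemma exists_lintegral_pow_mul_neg_deriv_le (H : NuAssumptions d ν a b β ℓ a₃ α₃) (hd : 0 < d) :
    ∃ C : ℝ, 0 < C ∧ ∀ r : ℝ, 0 < r → r ≤ 1 →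
      ∫⁻ s in Ioc r 1, ENNReal.ofReal (s ^ d * -deriv ν s) ≤
        ENNReal.ofReal (C * truncMoment d ν r) := by
  obtain ⟨C, hC, hCle⟩ := H.exists_integral_tail_le hd
  refine ⟨(d + 2) + d * C, by positivity, fun r hr0 hr => ?_⟩
  have hderiv := integrableOn_deriv_of_antitoneOn_Ioi H.ν_anti H.ν_diff (v := 1) hr0
  have hint : IntegrableOn (fun s => s ^ d * -deriv ν s) (Ioc r 1) :=
    Integrable.bdd_mul (c := 1) hderiv.neg (by fun_prop) (by
      filter_upwards [ae_restrict_mem measurableSet_Ioc] with s hs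
      rw [norm_pow, Real.norm_of_nonneg (hr0.trans hs.1).le]
      exact pow_le_one₀ (hr0.trans hs.1).le hs.2)
  rw [← ofReal_integral_eq_lintegral_ofReal hint]
  · apply ENNReal.ofReal_le_ofReal
    have hparts := intervalIntegral.integral_mul_deriv_eq_deriv_mul (a := r) (b := 1)
      (u := fun s => s ^ d) (u' := fun s => d * s ^ (d - 1)) (v := fun s => -ν s)
      (v' := fun s => -deriv ν s) (fun s _ => hasDerivAt_pow d s)
      (fun s hs => by
        rw [uIcc_of_le hr] at hs
        exact (H.ν_diff s (hr0.trans_le hs.1)).hasDerivAt.neg)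
      ((by fun_prop : Continuous fun s : ℝ => (d:ℝ) * s ^ (d - 1)).intervalIntegrable _ _)
      ((intervalIntegrable_iff_integrableOn_Ioc_of_le hr).2 hderiv.neg)
    rw [← intervalIntegral.integral_of_le hr, hparts]
    have h1 : ∫ s in r..1, (d * s ^ (d - 1)) * -ν s = -(d * ∫ s in Ioc r 1, s ^ (d - 1) * ν s) := by
      rw [intervalIntegral.integral_of_le hr, ← integral_const_mul, ← integral_neg]
      congr 1
      ext s
      ring
    have h2 : ∫ s in Ioc r 1, s ^ (d - 1) * ν s ≤ ∫ s in Ioi r, s ^ (d - 1) * ν s := by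
      refine setIntegral_mono_set (H.integrableOn_pow_sub_one_mul hd hr0) ?_
        Ioc_subset_Ioi_self.eventuallyLE
      filter_upwards [ae_restrict_mem measurableSet_Ioi] with s hs
      have hs0 : 0 < s := hr0.trans hs
      have := H.ν_pos s hs0
      simp only [Pi.zero_apply]
      positivity
    rw [h1]
    have h3 := mul_le_mul_of_nonneg_left (h2.trans (hCle r hr0 hr)) (Nat.cast_nonneg' (α := ℝ) d)
    have h4 := H.pow_mul_le_truncMoment hd hr0 hr
    have h5 := H.ν_pos 1 one_pos
    simp only [one_pow]
    linarith
  · filter_upwards [ae_restrict_mem measurableSet_Ioc] with s hs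
    have hs0 : 0 < s := hr0.trans hs.1
    exact mul_nonneg (by positivity)
      (neg_nonneg.2 (deriv_nonpos_of_antitoneOn_Ioi H.ν_anti hs0))

lemma measurable_nu1 (ν : ℝ → ℝ) : Measurable (nu1 ν) :=
  (measurable_deriv ν).neg.div (measurable_id.const_mul _)

lemma exists_setLIntegral_nu1_le (H : NuAssumptions d ν a b β ℓ a₃ α₃) (hd : 0 < d) :
    ∃ C : ℝ, 0 < C ∧ ∀ r : ℝ, 0 < r → r ≤ 1 →
      ∫⁻ y : EuclideanSpace ℝ (Fin (d + 2)) in norm ⁻¹' Ioc r 1, ENNReal.ofReal (nu1 ν ‖y‖) ≤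
        ENNReal.ofReal (C * truncMoment d ν r) := by
  have := nontrivial_euclideanSpace_fin (d := d + 2) (by omega)
  obtain ⟨C, hC, hCle⟩ := H.exists_lintegral_pow_mul_neg_deriv_le hd
  set σ := (volume : Measure (EuclideanSpace ℝ (Fin (d + 2)))).toSphere with hσ
  refine ⟨C * (σ.real univ + 1), by positivity, fun r hr0 hr => ?_⟩
  have hK := H.truncMoment_pos hd hr0 hr
  rw [setLIntegral_norm_preimage volume (F := fun y => ENNReal.ofReal (nu1 ν ‖y‖))
    ((measurable_nu1 ν).comp measurable_norm).ennreal_ofReal measurableSet_Ioc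
    (fun s hs => hr0.trans hs.1)]
  have h : ∀ ω : Metric.sphere (0 : EuclideanSpace ℝ (Fin (d + 2))) 1, ∫⁻ s in Ioc r 1,
      ENNReal.ofReal (s ^ (Module.finrank ℝ (EuclideanSpace ℝ (Fin (d + 2))) - 1)) *
        ENNReal.ofReal (nu1 ν ‖s • (ω : EuclideanSpace ℝ (Fin (d + 2)))‖) ≤
      ENNReal.ofReal (C * truncMoment d ν r) := fun ω => by
    refine (setLIntegral_mono' measurableSet_Ioc fun s hs => ?_).trans (hCle r hr0 hr)
    have hs0 : 0 < s := hr0.trans hs.1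
    rw [norm_smul, norm_eq_of_mem_sphere ω, mul_one, Real.norm_of_nonneg hs0.le,
      finrank_euclideanSpace_fin, ← ENNReal.ofReal_mul (by positivity)]
    exact ENNReal.ofReal_le_ofReal (H.pow_succ_mul_nu1_le hs0)
  calc _ ≤ ∫⁻ _, ENNReal.ofReal (C * truncMoment d ν r) ∂σ := lintegral_mono h
    _ = ENNReal.ofReal (C * truncMoment d ν r * σ.real univ) := by
      rw [lintegral_const, ENNReal.ofReal_mul (q := σ.real univ) (by positivity),
        ofReal_measureReal]
    _ ≤ _ := by
      apply ENNReal.ofReal_le_ofReal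
      nlinarith [mul_pos hC hK]

lemma exists_setLIntegral_tailProfile_mul_nu1_le (H : NuAssumptions d ν a b β ℓ a₃ α₃)
    (hβ1 : β < 1) :
    ∃ C : ℝ, 0 < C ∧ ∀ x : EuclideanSpace ℝ (Fin (d + 2)),
      ∫⁻ y in norm ⁻¹' Ioi 1,
        ENNReal.ofReal (tailProfile b β (ℓ + 1) ‖x - y‖) * ENNReal.ofReal (nu1 ν ‖y‖) ≤
      ENNReal.ofReal (C * tailProfile b β (ℓ + 1) ‖x‖) := by
  have := nontrivial_euclideanSpace_fin (d := d + 2) (by omega)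
  have hℓ : 0 ≤ ℓ + 1 := by linarith [H.ℓ_nonneg]
  obtain ⟨C₁, hC₁, hC₁le⟩ := H.exists_ν_shift_le_tailProfile
  obtain ⟨C₂, hC₂, hC₂le⟩ := exists_integral_tailProfile_conv_le
    (volume : Measure (EuclideanSpace ℝ (Fin (d + 2)))) H.hb H.β_pos hβ1 hℓ
  set A : ℝ := 2 ^ (ℓ + 1) * Real.exp b with hA
  have hA0 : 0 < A := by positivity
  refine ⟨A * C₁ * C₂, by positivity, fun x => ?_⟩
  obtain ⟨hconv, hconvle⟩ := hC₂le x
  have hm : Measurable fun y : EuclideanSpace ℝ (Fin (d + 2)) => tailProfile b β (ℓ + 1) ‖x - y‖ :=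
    ((continuous_tailProfile b β (ℓ + 1)).comp (by fun_prop : Continuous fun y => ‖x - y‖)).measurable
  have hm' : Measurable fun y : EuclideanSpace ℝ (Fin (d + 2)) => tailProfile b β (ℓ + 1) ‖y‖ :=
    ((continuous_tailProfile b β (ℓ + 1)).comp continuous_norm).measurable
  have hpos : Ioi (1:ℝ) ⊆ Ioi 0 := Ioi_subset_Ioi zero_le_one
  have hG : Measurable fun y => ENNReal.ofReal (A * C₁) * ENNReal.ofReal
      (tailProfile b β (ℓ + 1) ‖x - y‖ * tailProfile b β (ℓ + 1) ‖y‖) :=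
    (hm.mul hm').ennreal_ofReal.const_mul _
  have hray : ∀ ω : Metric.sphere (0 : EuclideanSpace ℝ (Fin (d + 2))) 1,
      ∫⁻ s in Ioi (1:ℝ),
        ENNReal.ofReal (s ^ (Module.finrank ℝ (EuclideanSpace ℝ (Fin (d + 2))) - 1)) *
        (ENNReal.ofReal (tailProfile b β (ℓ + 1) ‖x - s • (ω : EuclideanSpace ℝ (Fin (d + 2)))‖) *
          ENNReal.ofReal (nu1 ν ‖s • (ω : EuclideanSpace ℝ (Fin (d + 2)))‖)) ≤
      ∫⁻ s in Ioi (1:ℝ),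
        ENNReal.ofReal (s ^ (Module.finrank ℝ (EuclideanSpace ℝ (Fin (d + 2))) - 1)) *
        (ENNReal.ofReal (A * C₁) * ENNReal.ofReal
          (tailProfile b β (ℓ + 1) ‖x - s • (ω : EuclideanSpace ℝ (Fin (d + 2)))‖ *
            tailProfile b β (ℓ + 1) ‖s • (ω : EuclideanSpace ℝ (Fin (d + 2)))‖)) := fun ω => by
    have hn : ∀ s : ℝ, ‖s • (ω : EuclideanSpace ℝ (Fin (d + 2)))‖ = |s| := fun s => by
      rw [norm_smul, norm_eq_of_mem_sphere ω, mul_one, Real.norm_eq_abs]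
    set g : ℝ → ℝ := fun s =>
      tailProfile b β (ℓ + 1) ‖x - s • (ω : EuclideanSpace ℝ (Fin (d + 2)))‖ with hg
    have hg0 : ∀ s, 0 < g s := fun s => tailProfile_pos ..
    have hW : Measurable fun s => ENNReal.ofReal (s ^ d * g s) :=
      ((continuous_pow d).mul ((continuous_tailProfile b β (ℓ + 1)).comp
        (by fun_prop))).measurable.ennreal_ofReal
    have hWA : ∀ s t, 1 < s → s ≤ t → t ≤ s + 1 → ENNReal.ofReal (s ^ d * g s) ≤
        ENNReal.ofReal A * ENNReal.ofReal (t ^ d * g t) := fun s t hs hst hts => by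
      rw [← ENNReal.ofReal_mul hA0.le]
      apply ENNReal.ofReal_le_ofReal
      have h1 : g s ≤ A * g t := by
        refine tailProfile_le_of_abs_sub_le H.hb.le H.β_pos.le H.β_le hℓ
          ((abs_norm_sub_norm_le _ _).trans ?_)
        rw [sub_sub_sub_cancel_left, ← sub_smul, hn, abs_le]
        constructor <;> linarith
      have h2 := hg0 s
      have h3 := hg0 t
      have ht : 0 < t := by linarith
      calc s ^ d * g s ≤ t ^ d * (A * g t) := by gcongr
        _ = _ := by ring
    refine le_trans ?_ ((lintegral_mul_neg_deriv_le H.ν_pos H.ν_anti H.ν_diff hW hWA).trans ?_)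
    · refine setLIntegral_mono' measurableSet_Ioi fun s hs => ?_
      have hs0 : 0 < s := hpos hs
      have h1 := hg0 s
      rw [hn, abs_of_pos hs0, finrank_euclideanSpace_fin, ← ENNReal.ofReal_mul h1.le,
        ← ENNReal.ofReal_mul (by positivity), ← ENNReal.ofReal_mul (by positivity)]
      apply ENNReal.ofReal_le_ofReal
      have h2 := mul_le_mul_of_nonneg_left (H.pow_succ_mul_nu1_le hs0) h1.le
      calc _ = g s * (s ^ (d + 1) * nu1 ν s) := by
            rw [show d + 2 - 1 = d + 1 from rfl]; ring
        _ ≤ _ := h2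
        _ = _ := by ring
    · refine setLIntegral_mono' measurableSet_Ioi fun s hs => ?_
      have hs0 : 0 < s := hpos hs
      have h1 := hg0 s
      have h2 := hC₁le s hs
      rw [hn, abs_of_pos hs0, finrank_euclideanSpace_fin, ← ENNReal.ofReal_mul hA0.le,
        ← ENNReal.ofReal_mul (by positivity), ← ENNReal.ofReal_mul (by positivity),
        ← ENNReal.ofReal_mul (by positivity)]
      apply ENNReal.ofReal_le_ofReal
      rw [← tailProfile_add_one (le_of_lt hs)] at h2
      calc A * (s ^ d * g s) * ν (max 1 (s - 1))
          ≤ A * (s ^ d * g s) * (C₁ * (s * tailProfile b β (ℓ + 1) s)) := by gcongr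
        _ = _ := by rw [show d + 2 - 1 = d + 1 from rfl, pow_succ]; ring
  calc _ = _ := setLIntegral_norm_preimage volume (hm.ennreal_ofReal.mul
        ((measurable_nu1 ν).comp measurable_norm).ennreal_ofReal) measurableSet_Ioi hpos
    _ ≤ _ := lintegral_mono hray
    _ = _ := (setLIntegral_norm_preimage volume hG measurableSet_Ioi hpos).symm
    _ ≤ _ := setLIntegral_le_lintegral _ _
    _ = ENNReal.ofReal (A * C₁) * ENNReal.ofReal
        (∫ y, tailProfile b β (ℓ + 1) ‖x - y‖ * tailProfile b β (ℓ + 1) ‖y‖) := by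
      rw [lintegral_const_mul' _ _ ENNReal.ofReal_ne_top,
        ofReal_integral_eq_lintegral_ofReal hconv (Eventually.of_forall fun y =>
          (mul_pos (tailProfile_pos ..) (tailProfile_pos ..)).le)]
    _ ≤ _ := by
      rw [← ENNReal.ofReal_mul (by positivity), mul_assoc (A * C₁)]
      gcongr

lemma exists_setIntegral_ffun_mul_le (H : NuAssumptions d ν a b β ℓ a₃ α₃) (hd : 0 < d)
    (hβ1 : β < 1) :
    ∃ C : ℝ, 0 < C ∧ ∀ x : EuclideanSpace ℝ (Fin (d + 2)), ∀ r : ℝ, 0 < r → r ≤ 1 →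
      ∫ y in {y : EuclideanSpace ℝ (Fin (d + 2)) | 1 ≤ ‖x - y‖ ∧ r < ‖y‖},
        ffun d ν b β ℓ ‖x - y‖ * nu1 ν ‖y‖ ≤
      C * truncMoment d ν r * tailProfile b β (ℓ + 1) ‖x‖ := by
  have hℓ : 0 ≤ ℓ + 1 := by linarith [H.ℓ_nonneg]
  obtain ⟨C₁, hC₁, hC₁le⟩ := H.exists_setLIntegral_nu1_le hd
  obtain ⟨C₂, hC₂, hC₂le⟩ := H.exists_setLIntegral_tailProfile_mul_nu1_le hβ1
  have ha₃ := H.a₃_pos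
  have hK1 := H.truncMoment_pos hd one_pos le_rfl
  set A : ℝ := 2 ^ (ℓ + 1) * Real.exp b with hA
  have hA0 : 0 < A := by positivity
  refine ⟨Real.exp b * (A * C₁ + C₂ / (a₃ * truncMoment d ν 1)), by positivity,
    fun x r hr0 hr => ?_⟩
  have hK := H.truncMoment_pos hd hr0 hr
  have hx := tailProfile_pos b β (ℓ + 1) ‖x‖
  have hS := measurableSet_one_le_norm_sub_and_lt_norm x r
  set S := {y : EuclideanSpace ℝ (Fin (d + 2)) | 1 ≤ ‖x - y‖ ∧ r < ‖y‖} with hSdef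
  have hsub : S ⊆ norm ⁻¹' Ioc r 1 ∪ norm ⁻¹' Ioi 1 := fun y hy =>
    (le_or_gt ‖y‖ 1).imp (fun h => ⟨hy.2, h⟩) id
  set F : EuclideanSpace ℝ (Fin (d + 2)) → ENNReal := fun y =>
    ENNReal.ofReal (tailProfile b β (ℓ + 1) ‖x - y‖) * ENNReal.ofReal (nu1 ν ‖y‖) with hF
  have hle : ∫⁻ y in S, ENNReal.ofReal ‖ffun d ν b β ℓ ‖x - y‖ * nu1 ν ‖y‖‖ ≤
      ENNReal.ofReal (Real.exp b) * ∫⁻ y in S, F y := by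
    rw [← lintegral_const_mul' _ _ ENNReal.ofReal_ne_top]
    refine setLIntegral_mono' hS fun y hy => ?_
    have hν := H.nu1_nonneg (hr0.trans hy.2)
    rw [Real.norm_of_nonneg (mul_nonneg (H.ffun_nonneg hd hy.1) hν),
      ENNReal.ofReal_mul (H.ffun_nonneg hd hy.1), hF, ← mul_assoc,
      ← ENNReal.ofReal_mul (Real.exp_pos b).le]
    gcongr
    exact H.ffun_le_tailProfile hy.1
  have hnear : ∫⁻ y in norm ⁻¹' Ioc r 1, F y ≤
      ENNReal.ofReal (A * tailProfile b β (ℓ + 1) ‖x‖ * (C₁ * truncMoment d ν r)) := by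
    rw [ENNReal.ofReal_mul (by positivity)]
    refine le_trans ?_ (mul_le_mul_right (hC₁le r hr0 hr) _)
    rw [← lintegral_const_mul' _ _ ENNReal.ofReal_ne_top]
    refine setLIntegral_mono' (measurable_norm measurableSet_Ioc) fun y hy => ?_
    have h2 : tailProfile b β (ℓ + 1) ‖x - y‖ ≤ A * tailProfile b β (ℓ + 1) ‖x‖ :=
      tailProfile_le_of_abs_sub_le H.hb.le H.β_pos.le H.β_le hℓ
        ((abs_norm_sub_norm_le _ _).trans (by simpa using hy.2))
    simp only [hF]
    gcongr
  have hbound : ∫⁻ y in S, F y ≤ ENNReal.ofReal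
      (A * tailProfile b β (ℓ + 1) ‖x‖ * (C₁ * truncMoment d ν r) +
        C₂ * tailProfile b β (ℓ + 1) ‖x‖) := by
    rw [ENNReal.ofReal_add (by positivity) (by positivity)]
    exact (lintegral_mono_set hsub).trans ((lintegral_union_le _ _ _).trans
      (add_le_add hnear (hC₂le x)))
  refine (Real.le_norm_self _).trans ((norm_integral_le_lintegral_norm _).trans ?_)
  have h2 := H.truncMoment_one_le hd hr0 hr
  have h3 : 1 ≤ truncMoment d ν r / (a₃ * truncMoment d ν 1) := by
    rwa [le_div_iff₀ (by positivity), one_mul]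
  calc _ ≤ Real.exp b * (A * tailProfile b β (ℓ + 1) ‖x‖ * (C₁ * truncMoment d ν r) +
        C₂ * tailProfile b β (ℓ + 1) ‖x‖ * 1) := by
        refine ENNReal.toReal_le_of_le_ofReal (by positivity) (hle.trans ?_)
        rw [ENNReal.ofReal_mul (Real.exp_pos b).le, mul_one]
        gcongr
    _ ≤ Real.exp b * (A * tailProfile b β (ℓ + 1) ‖x‖ * (C₁ * truncMoment d ν r) +
        C₂ * tailProfile b β (ℓ + 1) ‖x‖ *
          (truncMoment d ν r / (a₃ * truncMoment d ν 1))) := by gcongr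
    _ = _ := by field_simp

lemma ftil_eq_of_le_one {r : ℝ} (hr0 : 0 < r) (hr : r ≤ 1) :
    ftil d ν b β ℓ r = (truncMoment d ν 1)⁻¹ * r ^ (-(d:ℝ)) * truncMoment d ν r := by
  rw [ftil, if_pos hr, phiHat_of_le_one le_rfl, phiHat_of_le_one hr, Real.rpow_neg hr0.le,
    Real.rpow_natCast, div_eq_mul_inv, mul_inv, inv_inv, mul_assoc]

lemma ffun_eq_of_le_one {r : ℝ} (hr0 : 0 < r) (hr : r ≤ 1) :
    ffun d ν b β ℓ r = (truncMoment d ν 1)⁻¹ * r ^ (-(d:ℝ) - 1) * truncMoment d ν r := by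
  rw [ffun, if_pos hr, phiHat_of_le_one le_rfl, phiHat_of_le_one hr,
    show -(d:ℝ) - 1 = -((d + 1 : ℕ) : ℝ) by push_cast; ring, Real.rpow_neg hr0.le,
    Real.rpow_natCast, div_eq_mul_inv, mul_inv, inv_inv, mul_assoc]

lemma ftil_eq_tailProfile {s : ℝ} (hs : 1 < s) :
    ftil d ν b β ℓ s = tailProfile b β ℓ s := by
  rw [ftil, if_neg hs.not_ge, tailProfile_of_one_le hs.le]

lemma ffun_eq_tailProfile {s : ℝ} (hs : 1 < s) :
    ffun d ν b β ℓ s = tailProfile b β (ℓ + 1) s := by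
  rw [ffun, if_neg hs.not_ge, tailProfile_of_one_le hs.le, neg_add']

end NuAssumptions

/-- condition (C) for 0 < β < 1. -/
theorem condition_C (d : ℕ) (hd : 0 < d) (ν : ℝ → ℝ) (a b β ℓ a₃ α₃ : ℝ)
    (H : NuAssumptions d ν a b β ℓ a₃ α₃) (hβlt : β < 1) :
    ∃ c : ℝ, 0 < c ∧
      (∀ r : ℝ, 0 < r → r ≤ 1 →
        ftil d ν b β ℓ r ≤ c * r ^ (-(d : ℝ)) * Psi d hd ν (1 / r)
        ∧ ffun d ν b β ℓ r ≤ c * r ^ (-(d : ℝ) - 1) * Psi d hd ν (1 / r))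
      ∧ (∀ x : EuclideanSpace ℝ (Fin d), 2 ≤ ‖x‖ → ∀ r : ℝ, 0 < r → r ≤ 1 →
        (∫ y in {y : EuclideanSpace ℝ (Fin d) | 1 ≤ ‖x - y‖ ∧ r < ‖y‖},
            ftil d ν b β ℓ ‖x - y‖ * ν ‖y‖)
          ≤ c * Psi d hd ν (1 / r) * ftil d ν b β ℓ ‖x‖)
      ∧ (∀ x : EuclideanSpace ℝ (Fin (d + 2)), 2 ≤ ‖x‖ → ∀ r : ℝ, 0 < r → r ≤ 1 →
        (∫ y in {y : EuclideanSpace ℝ (Fin (d + 2)) | 1 ≤ ‖x - y‖ ∧ r < ‖y‖},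
            ffun d ν b β ℓ ‖x - y‖ * nu1 ν ‖y‖)
          ≤ c * Psi d hd ν (1 / r) * ffun d ν b β ℓ ‖x‖) := by
  obtain ⟨C₀, hC₀, hΨ⟩ := H.exists_truncMoment_le_Psi hd
  obtain ⟨C₁, hC₁, hftil⟩ := H.exists_setIntegral_ftil_mul_le hd hβlt
  obtain ⟨C₂, hC₂, hffun⟩ := H.exists_setIntegral_ffun_mul_le hd hβlt
  have hK1 := H.truncMoment_pos hd one_pos le_rfl
  set B : ℝ := (truncMoment d ν 1)⁻¹ + C₁ + C₂ with hB
  have hBK : (truncMoment d ν 1)⁻¹ ≤ B := by linarith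
  have hB1 : C₁ ≤ B := by have := inv_pos.2 hK1; linarith
  have hB2 : C₂ ≤ B := by have := inv_pos.2 hK1; linarith
  have key : ∀ {C r t : ℝ}, C ≤ B → 0 ≤ t → 0 < r → r ≤ 1 →
      C * truncMoment d ν r * t ≤ B * C₀ * Psi d hd ν (1 / r) * t := fun {C r t} hC ht hr0 hr => by
    have hK := H.truncMoment_pos hd hr0 hr
    have hB0 : 0 < B := by positivity
    calc C * truncMoment d ν r * t ≤ B * (C₀ * Psi d hd ν (1 / r)) * t := by
          gcongr
          exact hΨ r hr0 hr
      _ = _ := by ring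
  refine ⟨B * C₀, by positivity, fun r hr0 hr => ⟨?_, ?_⟩, fun x hx r hr0 hr => ?_,
    fun x hx r hr0 hr => ?_⟩
  · rw [NuAssumptions.ftil_eq_of_le_one hr0 hr, mul_right_comm, mul_right_comm (B * C₀)]
    exact key hBK (by positivity) hr0 hr
  · rw [NuAssumptions.ffun_eq_of_le_one hr0 hr, mul_right_comm, mul_right_comm (B * C₀)]
    exact key hBK (by positivity) hr0 hr
  · rw [NuAssumptions.ftil_eq_tailProfile (s := ‖x‖) (by linarith)]
    exact (hftil x r hr0 hr).trans (key hB1 (tailProfile_pos ..).le hr0 hr)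
  · rw [NuAssumptions.ffun_eq_tailProfile (s := ‖x‖) (by linarith)]
    exact (hffun x r hr0 hr).trans (key hB2 (tailProfile_pos ..).le hr0 hr)
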